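/- Let C be a diamond category and W a formation. Let G, E be objects of C and φ: G → E an epimorphism that is not relative-W, and let H̄ ∈ W. Then ∑_{F ∈ I, F^W ≅ H̄} ∑_{ρ ∈ Epi(F,E)} ∑_{π ∈ Epi(G,F), ρ∘π = φ} μ(π)/|Aut(F)| = 0, where I is the set of isomorphism classes of C (the sums are finite, being supported on quotients of G). -/

import Mathlib

open CategoryTheory Opposite Filter Topology MeasureTheory
open scoped ENNReal Classical

universe u

namespace MomentCat

variable {C : Type u} [SmallCategory C]

/-- The poset of isomorphism classes of quotient objects of `G`,
realized as subobjects of `op G` in `Cᵒᵖ`.  The order is: `a ≤ b` iff `a` is a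
further quotient of `b`, so that `⊤` is the class of the identity `G → G`. -/
abbrev Quotients (G : C) := Subobject (op G)

/-- The join of two quotient classes (the least upper bound, when it exists). -/
noncomputable def qSup {G : C} (a b : Quotients G) : Quotients G :=
  if h : ∃ c, IsLUB {a, b} c then h.choose else a

/-- The meet of two quotient classes (the greatest lower bound, when it exists). -/
noncomputable def qInf {G : C} (a b : Quotients G) : Quotients G :=
  if h : ∃ c, IsGLB {a, b} c then h.choose else a

/-- The join of a set of quotient classes (when it exists). -/
noncomputable def qsSup {G : C} (s : Set (Quotients G)) : Quotients G :=
  if h : ∃ c, IsLUB s c then h.choose else ⊤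

/-- The quotient class determined by an epimorphism `π : G ⟶ F`. -/
noncomputable def quotOf {G F : C} (π : G ⟶ F) (h : Epi π) : Quotients G :=
  haveI := h
  Subobject.mk π.op

/-- The underlying object of a quotient class. -/
noncomputable def qObj {G : C} (a : Quotients G) : C :=
  unop (Subobject.underlying.obj a)

/-- An object is minimal if its only quotient is itself. -/
def IsMinimalObj (G : C) : Prop := Subsingleton (Quotients G)

/-- An epimorphism is simple if it is not an isomorphism and the interval
`[F, G]` contains only the two endpoints. -/
def IsSimpleEpi {G F : C} (π : G ⟶ F) : Prop :=
  ∃ h : Epi π, ¬IsIso π ∧ ∀ X : Quotients G, quotOf π h ≤ X → X = quotOf π h ∨ X = ⊤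

/-- The interval `[a, ⊤]` is a complemented lattice. -/
def IntervalComplTop {G : C} (a : Quotients G) : Prop :=
  ∀ X : Quotients G, a ≤ X → ∃ Y : Quotients G, a ≤ Y ∧ qSup X Y = ⊤ ∧ qInf X Y = a

/-- The interval `[a, b]` is a complemented lattice. -/
def IntervalCompl {G : C} (a b : Quotients G) : Prop :=
  ∀ X : Quotients G, a ≤ X → X ≤ b →
    ∃ Y : Quotients G, a ≤ Y ∧ Y ≤ b ∧ qSup X Y = b ∧ qInf X Y = a

/-- An epimorphism `π : G ⟶ F` is semisimple if the interval `[F,G]` is complemented. -/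
def IsSemisimpleEpi {G F : C} (π : G ⟶ F) : Prop :=
  ∃ h : Epi π, IntervalComplTop (quotOf π h)

/-- A set of objects (stable under isomorphism) closed under quotients. -/
def DownwardClosed (S : Set C) : Prop :=
  ∀ G ∈ S, ∀ (F : C) (π : G ⟶ F), Epi π → F ∈ S

/-- A set of objects closed under joins of quotients of a common object. -/
def JoinClosed (S : Set C) : Prop :=
  ∀ (G : C) (a b : Quotients G), qObj a ∈ S → qObj b ∈ S →
    (∃ c, IsLUB {a, b} c) → qObj (qSup a b) ∈ S

/-- A set of objects containing all minimal objects. -/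
def MinClosed (S : Set C) : Prop := ∀ G : C, IsMinimalObj G → G ∈ S

/-- A formation: downward-closed, join-closed, containing all minimal objects. -/
def IsFormation (S : Set C) : Prop := DownwardClosed S ∧ JoinClosed S ∧ MinClosed S

/-- The smallest downward-closed join-closed set containing `B` and all minimal objects. -/
def levelGen (B : Set C) : Set C := ⋂₀ {S : Set C | IsFormation S ∧ B ⊆ S}

/-- A level is a formation generated by a finite set of objects. -/
def IsLevel (S : Set C) : Prop := ∃ B : Set C, B.Finite ∧ S = levelGen B

/-- The type of isomorphism classes of objects of `C`. -/
abbrev IsoCls (C : Type u) [SmallCategory C] := Quotient (CategoryTheory.isIsomorphicSetoid C)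

/-- The isomorphism class of an object. -/
def cls (G : C) : IsoCls C := Quotient.mk (CategoryTheory.isIsomorphicSetoid C) G

/-- The set of epimorphisms from `G` to `F`. -/
abbrev Epis (G F : C) := {π : G ⟶ F // Epi π}

/-- There is a chain of covers of length `d` from `a` to `b` (i.e. the morphism
`qObj b → qObj a` has dimension `d`). -/
def CovChain {G : C} (a b : Quotients G) (d : ℕ) : Prop :=
  ∃ c : Fin (d + 1) → Quotients G, c 0 = a ∧ c (Fin.last d) = b ∧
    ∀ i : Fin d, c i.castSucc ⋖ c i.succ

/-- An epimorphism has dimension `d`. -/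
def EpiDim {G F : C} (π : G ⟶ F) (h : Epi π) (d : ℕ) : Prop :=
  CovChain (quotOf π h) ⊤ d

/-- A set of isomorphism classes is narrow if each of its members receives simple
epimorphisms from only finitely many of its members (up to isomorphism). -/
def Narrow (S : Set C) : Prop :=
  ∀ G ∈ S, {X : IsoCls C | X.out ∈ S ∧ ∃ π : X.out ⟶ G, IsSimpleEpi π}.Finite

/-- The minimal quotient: the bottom of the quotient poset, when it exists. -/
noncomputable def qBot (G : C) : Quotients G :=
  if h : ∃ b : Quotients G, ∀ x, b ≤ x then h.choose else ⊤

/-- `G` has complexity at most `k`: the map to the minimal quotient is a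
composition of `k` semisimple epimorphisms. -/
def complexityLE (G : C) (k : ℕ) : Prop :=
  ∃ c : Fin (k + 1) → Quotients G, c 0 = qBot G ∧ c (Fin.last k) = ⊤ ∧
    ∀ i : Fin k, c i.castSucc ≤ c i.succ ∧ IntervalCompl (c i.castSucc) (c i.succ)

/-- A diamond category. -/
structure IsDiamond (C : Type u) [SmallCategory C] : Prop where
  /-- quotient posets are finite … -/
  quotFinite : ∀ G : C, Finite (Quotients G)
  /-- … and are lattices: all pairwise joins exist … -/
  lub : ∀ (G : C) (a b : Quotients G), ∃ c, IsLUB {a, b} c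
  /-- … and all pairwise meets exist … -/
  glb : ∀ (G : C) (a b : Quotients G), ∃ c, IsGLB {a, b} c
  /-- … and are modular. -/
  modular : ∀ (G : C) (a b x : Quotients G), a ≤ b →
    qSup a (qInf x b) = qInf (qSup a x) b
  /-- automorphism groups are finite -/
  autFinite : ∀ G : C, Finite (Aut G)
  /-- levels are narrow -/
  levelNarrow : ∀ S : Set C, IsLevel S → Narrow S
  /-- countably many isomorphism classes of minimal objects -/
  minCountable : Set.Countable {X : IsoCls C | IsMinimalObj X.out}

/-- A family assigning to each object the Möbius function of its quotient poset:
`mob G x x = 1` and for `x < y`, `∑_{x ≤ z ≤ y} mob G x z = 0`. -/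
def IsMobiusFamily (mob : ∀ G : C, Quotients G → Quotients G → ℝ) : Prop :=
  ∀ G : C, (∀ x : Quotients G, mob G x x = 1) ∧
    ∀ x y : Quotients G, x < y → ∑ᶠ z ∈ Set.Icc x y, mob G x z = 0

/-- `μ(π) = μ(F, G)` for an epimorphism `π : G ⟶ F`. -/
noncomputable def muEpi (mob : ∀ G : C, Quotients G → Quotients G → ℝ)
    {G F : C} (π : G ⟶ F) (h : Epi π) : ℝ :=
  mob G (quotOf π h) ⊤

/-- `μ̂(F,G) = ∑_{π ∈ Epi(G,F)/Aut(F)} μ(π) = (∑_{π ∈ Epi(G,F)} μ(π))/|Aut F|`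
(the `Aut F`-action on epimorphisms being free). -/
noncomputable def muHat (mob : ∀ G : C, Quotients G → Quotients G → ℝ) (F G : C) : ℝ :=
  (∑' π : Epis G F, muEpi mob π.1 π.2) / (Nat.card (Aut F) : ℝ)

/-- `S_{G,F} = |Epi(G,F)|/|Aut F|`. -/
noncomputable def SQ (G F : C) : ℝ :=
  (Nat.card (Epis G F) : ℝ) / (Nat.card (Aut F) : ℝ)

/-- `T_{G,F} = μ̂(F,G)`. -/
noncomputable def TQ (mob : ∀ G : C, Quotients G → Quotients G → ℝ) (G F : C) : ℝ :=
  muHat mob F G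

/-- `Z(π)`: the number of `H ∈ [F,G]` satisfying the distributive law. -/
noncomputable def Zfn {G F : C} (π : G ⟶ F) (h : Epi π) : ℕ :=
  Nat.card {H : Quotients G // quotOf π h ≤ H ∧ ∀ K₁ K₂ : Quotients G,
    quotOf π h ≤ K₁ → quotOf π h ≤ K₂ →
      qSup H (qInf K₁ K₂) = qInf (qSup H K₁) (qSup H K₂)}

/-- The isomorphism classes lying in `W`. -/
abbrev WSub (W : Set C) := {X : IsoCls C // X.out ∈ W}

/-- `(M_G)` is well-behaved at `W`:
`∑_{G ∈ W} ∑_{π ∈ Epi(G,F)} (|μ(F,G)|/|Aut G|) Z(π)³ |M_G| < ∞` for every `F ∈ W`. -/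
def WellBehavedAt (mob : ∀ G : C, Quotients G → Quotients G → ℝ) (M : IsoCls C → ℝ)
    (W : Set C) : Prop :=
  ∀ F : C, F ∈ W → Summable (fun q : Σ X : WSub W, Epis X.1.out F =>
    |mob q.1.1.out (quotOf q.2.1 q.2.2) ⊤| / (Nat.card (Aut q.1.1.out) : ℝ)
      * ((Zfn q.2.1 q.2.2 : ℝ)) ^ 3 * |M q.1.1|)

/-- The `W`-quotient `G^W`: the join of all quotients of `G` lying in `W`. -/
noncomputable def wQuot (W : Set C) (G : C) : Quotients G :=
  qsSup {a : Quotients G | qObj a ∈ W}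

/-- An epimorphism `φ : G ⟶ E` is relative-`W` if `G → G^W ∨ E` is an isomorphism. -/
def RelativeW (W : Set C) {G E : C} (φ : G ⟶ E) (h : Epi φ) : Prop :=
  qSup (wQuot W G) (quotOf φ h) = ⊤

/-- `v_{W,F} = ∑_{G ∈ W} μ̂(F,G) M_G / |Aut G|`. -/
noncomputable def vWF (mob : ∀ G : C, Quotients G → Quotients G → ℝ) (M : IsoCls C → ℝ)
    (W : Set C) (F : C) : ℝ :=
  ∑' X : WSub W, muHat mob F X.1.out * M X.1 / (Nat.card (Aut X.1.out) : ℝ)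

theorem epiComp {G F E : C} {π : G ⟶ F} {ρ : F ⟶ E} (h1 : Epi π) (h2 : Epi ρ) :
    Epi (π ≫ ρ) := by
  haveI := h1; haveI := h2; infer_instance

/-- The radical of an epimorphism with class `a`: the join of all minimal
elements of `[a, ⊤]` distinct from `a` (together with `a` itself). -/
noncomputable def radicalEl {G : C} (a : Quotients G) : Quotients G :=
  qsSup (insert a {X : Quotients G | a ⋖ X})

end MomentCat

namespace MomentCat

section Abstract

variable {α : Type*} [PartialOrder α] [Fintype α]

theorem mob_eq_mu [LocallyFiniteOrder α] (m : α → α → ℝ) (h1 : ∀ x, m x x = 1)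
    (h2 : ∀ x y, x < y → ∑ᶠ z ∈ Set.Icc x y, m x z = 0) (x y : α) (hxy : x ≤ y) :
    m x y = IncidenceAlgebra.mu ℝ x y := by
  induction y using (wellFounded_lt (α := α)).induction with
  | _ y ih =>
    rcases hxy.eq_or_lt with rfl | hlt
    · simp [h1]
    · have h := h2 x y hlt
      rw [← Finset.coe_Icc, finsum_mem_coe_finset, Finset.Icc_eq_cons_Ico hxy,
        Finset.sum_cons] at h
      rw [IncidenceAlgebra.mu_eq_neg_sum_Ico_of_ne hlt.ne, eq_neg_iff_add_eq_zero, ← h]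
      congr 1
      refine Finset.sum_congr rfl fun z hz => ?_
      rw [Finset.mem_Ico] at hz
      exact (ih z hz.2 hz.1).symm

theorem mob_dual [OrderTop α] (m : α → α → ℝ) (h1 : ∀ x, m x x = 1)
    (h2 : ∀ x y, x < y → ∑ᶠ z ∈ Set.Icc x y, m x z = 0) (y : α) (hy : y < ⊤) :
    ∑ a with y ≤ a, m a ⊤ = 0 := by
  haveI : LocallyFiniteOrder α := Fintype.toLocallyFiniteOrder
  have h := IncidenceAlgebra.sum_Icc_mu_left (𝕜 := ℝ) y ⊤
  rw [if_neg hy.ne] at h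
  rw [← h]
  refine Finset.sum_congr ?_ fun z _ => mob_eq_mu m h1 h2 z ⊤ le_top
  ext z
  simp

theorem weisner [OrderTop α] (m : α → ℝ) (hm : ∀ y < ⊤, ∑ a with y ≤ a, m a = 0)
    (w : α) (hw : w ≠ ⊤) (f : α → α) (hf : ∀ a, IsGLB {a, w} (f a)) (y : α) :
    ∑ a with f a = y, m a = 0 := by
  have hfw : ∀ a, f a ≤ w := fun a => (hf a).1 (by simp)
  induction y using (wellFounded_gt (α := α)).induction with
  | _ y ih =>
    by_cases hy : y ≤ w
    · have h := hm y (hy.trans_lt hw.lt_top)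
      have hiff : ∀ a, y ≤ a ↔ y ≤ f a := fun a => by
        rw [le_isGLB_iff (hf a)]
        simp [mem_lowerBounds, hy]
      rw [← Finset.sum_fiberwise (s := Finset.univ.filter (fun a => y ≤ a)) f m] at h
      rw [Finset.sum_eq_single y] at h
      · rw [← h]
        refine Finset.sum_congr ?_ fun _ _ => rfl
        ext a
        simp only [Finset.mem_filter, Finset.mem_univ, true_and]
        constructor
        · intro ha
          exact ⟨(hiff a).2 ha.ge, ha⟩
        · exact fun ha => ha.2
      · intro z _ hz
        by_cases hyz : y ≤ z
        · rw [← ih z (lt_of_le_of_ne hyz (Ne.symm hz))]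
          refine Finset.sum_congr ?_ fun _ _ => rfl
          ext a
          simp only [Finset.mem_filter, Finset.mem_univ, true_and]
          constructor
          · exact fun ha => ha.2
          · intro ha
            exact ⟨(hiff a).2 (ha ▸ hyz), ha⟩
        · refine Finset.sum_eq_zero fun a ha => ?_
          simp only [Finset.mem_filter, Finset.mem_univ, true_and] at ha
          exact absurd (ha.2 ▸ (hiff a).1 ha.1) hyz
      · simp
    · refine Finset.sum_eq_zero fun a ha => ?_
      simp only [Finset.mem_filter, Finset.mem_univ, true_and] at ha
      exact absurd (ha ▸ hfw a) hy

theorem weisner_pred [OrderTop α] (m : α → ℝ) (hm : ∀ y < ⊤, ∑ a with y ≤ a, m a = 0)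
    (w : α) (hw : w ≠ ⊤) (f : α → α) (hf : ∀ a, IsGLB {a, w} (f a)) (Q : α → Prop)
    [DecidablePred Q]
    (hQ : ∀ a b, f a = f b → Q a → Q b) :
    ∑ a with Q a, m a = 0 := by
  rw [← Finset.sum_fiberwise (s := Finset.univ.filter Q) f m]
  refine Finset.sum_eq_zero fun y _ => ?_
  by_cases h : ∃ a, f a = y ∧ Q a
  · obtain ⟨a, ha, hqa⟩ := h
    rw [← weisner m hm w hw f hf y]
    refine Finset.sum_congr ?_ fun _ _ => rfl
    ext b
    simp only [Finset.mem_filter, Finset.mem_univ, true_and]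
    exact ⟨fun hb => hb.2, fun hb => ⟨hQ a b (ha.trans hb.symm) hqa, hb⟩⟩
  · refine Finset.sum_eq_zero fun a ha => ?_
    simp only [Finset.mem_filter, Finset.mem_univ, true_and] at ha
    exact absurd ⟨a, ha.2, ha.1⟩ h

end Abstract

section Cat

variable {C : Type u} [SmallCategory C]

theorem quotOf_le_iff {G F F' : C} (π : G ⟶ F) (h : Epi π) (π' : G ⟶ F') (h' : Epi π') :
    quotOf π h ≤ quotOf π' h' ↔ ∃ r : F' ⟶ F, π' ≫ r = π := by
  haveI := h
  haveI := h'
  unfold quotOf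
  constructor
  · intro hle
    refine ⟨(Subobject.ofMkLEMk π.op π'.op hle).unop, ?_⟩
    apply Quiver.Hom.op_inj
    exact Subobject.ofMkLEMk_comp hle
  · rintro ⟨r, rfl⟩
    exact Subobject.mk_le_mk_of_comm r.op rfl

/-- The projection to the chosen object of a quotient class. -/
noncomputable def qArr {G : C} (a : Quotients G) : G ⟶ qObj a := (Subobject.arrow a).unop

theorem qArr_epi {G : C} (a : Quotients G) : Epi (qArr a) := by
  haveI : Mono (qArr a).op := Subobject.arrow_mono a
  exact unop_epi_of_mono (qArr a).op

theorem quotOf_qArr {G : C} (a : Quotients G) : quotOf (qArr a) (qArr_epi a) = a :=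
  Subobject.mk_arrow a

theorem quotOf_eq_iso {G F F' : C} (π : G ⟶ F) (h : Epi π) (π' : G ⟶ F') (h' : Epi π')
    (he : quotOf π h = quotOf π' h') : ∃ i : F ≅ F', π ≫ i.hom = π' := by
  obtain ⟨r, hr⟩ := (quotOf_le_iff π h π' h').1 he.le
  obtain ⟨s, hs⟩ := (quotOf_le_iff π' h' π h).1 he.ge
  refine ⟨⟨s, r, ?_, ?_⟩, hs⟩
  · rw [← cancel_epi π, ← Category.assoc, hs, hr, Category.comp_id]
  · rw [← cancel_epi π', ← Category.assoc, hr, hs, Category.comp_id]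

theorem quotOf_comp_iso {G F F' : C} (π : G ⟶ F) (h : Epi π) (i : F ≅ F')
    (h' : Epi (π ≫ i.hom)) : quotOf (π ≫ i.hom) h' = quotOf π h := by
  apply le_antisymm
  · exact (quotOf_le_iff _ _ _ _).2 ⟨i.hom, rfl⟩
  · exact (quotOf_le_iff _ _ _ _).2 ⟨i.inv, by simp⟩

theorem qObj_quotOf {G F : C} (π : G ⟶ F) (h : Epi π) : Nonempty (qObj (quotOf π h) ≅ F) := by
  obtain ⟨i, _⟩ := quotOf_eq_iso _ (qArr_epi (quotOf π h)) π h (quotOf_qArr _)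
  exact ⟨i⟩

theorem mem_of_iso {S : Set C} (hS : DownwardClosed S) {X Y : C} (i : X ≅ Y) (hX : X ∈ S) :
    Y ∈ S := hS X hX Y i.hom inferInstance

theorem le_quotOf_iff {G F : C} (π : G ⟶ F) (h : Epi π) (a : Quotients G) :
    a ≤ quotOf π h ↔ ∃ r, π ≫ r = qArr a := by
  conv_lhs => rw [← quotOf_qArr a]
  exact quotOf_le_iff _ _ _ _

theorem qSup_isLUB (hC : IsDiamond C) {G : C} (a b : Quotients G) : IsLUB {a, b} (qSup a b) := by
  unfold qSup
  rw [dif_pos (hC.lub G a b)]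
  exact (hC.lub G a b).choose_spec

theorem qInf_isGLB (hC : IsDiamond C) {G : C} (a b : Quotients G) : IsGLB {a, b} (qInf a b) := by
  unfold qInf
  rw [dif_pos (hC.glb G a b)]
  exact (hC.glb G a b).choose_spec

theorem exists_bot (hC : IsDiamond C) (G : C) : ∃ b : Quotients G, ∀ x, b ≤ x := by
  haveI := hC.quotFinite G
  obtain ⟨b, hb⟩ := (Set.toFinite (Set.univ : Set (Quotients G))).exists_minimal ⟨⊤, trivial⟩
  refine ⟨b, fun x => ?_⟩
  have h := qInf_isGLB hC b x
  have h1 : qInf b x ≤ b := h.1 (by simp)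
  have h2 : qInf b x ≤ x := h.1 (by simp)
  exact (hb.2 trivial h1).trans h2

theorem minimal_of_bot {G : C} (b : Quotients G) (hb : ∀ x, b ≤ x) : IsMinimalObj (qObj b) := by
  have key : ∀ c : Quotients (qObj b), c = ⊤ := by
    intro c
    haveI := qArr_epi b
    haveI := qArr_epi c
    have h := hb (quotOf (qArr b ≫ qArr c) inferInstance)
    rw [le_quotOf_iff] at h
    obtain ⟨r, hr⟩ := h
    rw [Category.assoc] at hr
    have hr' : qArr c ≫ r = 𝟙 _ := by
      rw [← cancel_epi (qArr b), hr, Category.comp_id]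
    rw [eq_top_iff]
    conv_rhs => rw [← quotOf_qArr c]
    rw [le_quotOf_iff]
    exact ⟨r ≫ qArr ⊤, by rw [← Category.assoc, hr', Category.id_comp]⟩
  exact ⟨fun x y => (key x).trans (key y).symm⟩

theorem wQuot_isGreatest (hC : IsDiamond C) {W : Set C} (hW : IsFormation W) (G : C) :
    IsGreatest {a : Quotients G | qObj a ∈ W} (wQuot W G) := by
  have hex : ∃ c, IsGreatest {a : Quotients G | qObj a ∈ W} c := by
    haveI := hC.quotFinite G
    obtain ⟨b, hb⟩ := exists_bot hC G
    have hbW : b ∈ {a : Quotients G | qObj a ∈ W} := hW.2.2 _ (minimal_of_bot b hb)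
    obtain ⟨m, hm⟩ := (Set.toFinite {a : Quotients G | qObj a ∈ W}).exists_maximal ⟨b, hbW⟩
    refine ⟨m, hm.1, fun x hx => ?_⟩
    have h := qSup_isLUB hC m x
    have h1 : m ≤ qSup m x := h.1 (by simp)
    have h2 : x ≤ qSup m x := h.1 (by simp)
    exact h2.trans (hm.2 (hW.2.1 G m x hm.1 hx (hC.lub G m x)) h1)
  obtain ⟨c, hc⟩ := hex
  have hl : ∃ c, IsLUB {a : Quotients G | qObj a ∈ W} c := ⟨c, hc.isLUB⟩
  have : wQuot W G = c := by
    unfold wQuot qsSup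
    rw [dif_pos hl]
    exact hl.choose_spec.unique hc.isLUB
  rw [this]
  exact hc

theorem wQuot_quot (hC : IsDiamond C) {W : Set C} (hW : IsFormation W) {G F : C}
    (π : G ⟶ F) (h : Epi π) :
    Nonempty (qObj (wQuot W F) ≅ qObj (qInf (quotOf π h) (wQuot W G))) := by
  haveI := h
  haveI := qArr_epi (wQuot W F)
  have hF := wQuot_isGreatest hC hW F
  have hG := wQuot_isGreatest hC hW G
  set p : G ⟶ qObj (wQuot W F) := π ≫ qArr (wQuot W F) with hp
  have hpe : Epi p := epiComp h (qArr_epi _)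
  obtain ⟨i⟩ := qObj_quotOf p hpe
  have hglb : IsGLB {quotOf π h, wQuot W G} (quotOf p hpe) := by
    constructor
    · rintro x (rfl | rfl)
      · exact (quotOf_le_iff _ _ _ _).2 ⟨_, rfl⟩
      · exact hG.2 (mem_of_iso hW.1 i.symm hF.1)
    · intro d hd
      have hd1 : d ≤ quotOf π h := hd (by simp)
      have hd2 : d ≤ wQuot W G := hd (by simp)
      obtain ⟨q, hq⟩ := (le_quotOf_iff _ _ _).1 hd1
      have hqe : Epi q := by
        haveI : Epi (π ≫ q) := by rw [hq]; exact qArr_epi d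
        exact epi_of_epi π q
      have hdW : qObj d ∈ W := by
        rw [← quotOf_qArr (wQuot W G), le_quotOf_iff] at hd2
        obtain ⟨r, hr⟩ := hd2
        haveI : Epi (qArr (wQuot W G) ≫ r) := by rw [hr]; exact qArr_epi d
        exact hW.1 _ hG.1 _ r (epi_of_epi (qArr (wQuot W G)) r)
      obtain ⟨j⟩ := qObj_quotOf q hqe
      have hle : quotOf q hqe ≤ wQuot W F := hF.2 (mem_of_iso hW.1 j.symm hdW)
      rw [← quotOf_qArr (wQuot W F), quotOf_le_iff] at hle
      obtain ⟨s, hs⟩ := hle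
      rw [le_quotOf_iff]
      exact ⟨s, by rw [hp, Category.assoc, hs, hq]⟩
  rw [(qInf_isGLB hC _ _).unique hglb]
  exact ⟨i.symm⟩

/-- The fibre of `π ↦ [π]` over the class of `π₀` is a torsor under `Aut F`. -/
noncomputable def fibreEquiv {G F : C} (π₀ : Epis G F) :
    (F ≅ F) ≃ {π : Epis G F // quotOf π.1 π.2 = quotOf π₀.1 π₀.2} :=
  Equiv.ofBijective
    (fun i : F ≅ F => ⟨⟨π₀.1 ≫ i.hom, epiComp π₀.2 inferInstance⟩, quotOf_comp_iso _ _ _ _⟩) <| by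
    haveI := π₀.2
    constructor
    · intro i j hij
      have : π₀.1 ≫ i.hom = π₀.1 ≫ j.hom := congrArg (fun x => x.1.1) hij
      rw [cancel_epi] at this
      exact Iso.ext this
    · rintro ⟨⟨π, hπ⟩, he⟩
      obtain ⟨i, hi⟩ := quotOf_eq_iso π₀.1 π₀.2 π hπ he.symm
      exact ⟨i, Subtype.ext (Subtype.ext hi)⟩

theorem epis_finite (hC : IsDiamond C) (G F : C) : Finite (Epis G F) := by
  haveI := hC.quotFinite G
  haveI : Finite (F ≅ F) := hC.autFinite F
  rw [← Set.finite_univ_iff]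
  refine Set.Finite.preimage' (f := fun π : Epis G F => quotOf π.1 π.2)
    (s := Set.univ) Set.finite_univ fun a _ => ?_
  by_cases h : ∃ π₀ : Epis G F, quotOf π₀.1 π₀.2 = a
  · obtain ⟨π₀, rfl⟩ := h
    exact Finite.of_equiv _ (fibreEquiv π₀)
  · push Not at h
    convert! Set.finite_empty
    ext π
    simpa using h π

/-- Pairs `(ρ, π)` with `ρ ∘ π = φ` are the same as `π` whose class lies above that of `φ`. -/
noncomputable def pairEquiv {G E F : C} (φ : G ⟶ E) (hφ : Epi φ) :
    (Σ ρ : Epis F E, {p : Epis G F // p.1 ≫ ρ.1 = φ}) ≃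
      {p : Epis G F // quotOf φ hφ ≤ quotOf p.1 p.2} :=
  Equiv.ofBijective
    (fun x => ⟨x.2.1, (quotOf_le_iff _ _ _ _).2 ⟨x.1.1, x.2.2⟩⟩) <| by
    constructor
    · rintro ⟨⟨ρ, hρ⟩, ⟨⟨π, hπ⟩, h⟩⟩ ⟨⟨ρ', hρ'⟩, ⟨⟨π', hπ'⟩, h'⟩⟩ he
      have he' : π = π' := congrArg (fun x => x.1.1) he
      subst he'
      dsimp only at h h'
      have : ρ = ρ' := by
        rw [← cancel_epi π, h, h']
      subst this
      rfl
    · rintro ⟨⟨π, hπ⟩, h⟩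
      obtain ⟨ρ, hρ⟩ := (quotOf_le_iff _ _ _ _).1 h
      have hρe : Epi ρ := by
        haveI : Epi (π ≫ ρ) := by rw [hρ]; exact hφ
        exact epi_of_epi π ρ
      exact ⟨⟨⟨ρ, hρe⟩, ⟨⟨π, hπ⟩, hρ⟩⟩, rfl⟩

theorem inner_sum (hC : IsDiamond C) {G E F : C} [Fintype (Quotients G)]
    (φ : G ⟶ E) (hφ : Epi φ) (m : Quotients G → ℝ) :
    (∑' ρ : Epis F E, ∑' π : {p : Epis G F // p.1 ≫ ρ.1 = φ},
      m (quotOf π.1.1 π.1.2) / (Nat.card (Aut F) : ℝ)) =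
    ∑ a : Quotients G, if quotOf φ hφ ≤ a ∧ Nonempty (qObj a ≅ F) then m a else 0 := by
  haveI := epis_finite hC G F
  haveI := epis_finite hC F E
  haveI := hC.autFinite F
  haveI := Fintype.ofFinite (Epis G F)
  haveI := Fintype.ofFinite (Epis F E)
  haveI := Fintype.ofFinite (Aut F)
  have hcard : (Nat.card (Aut F) : ℝ) ≠ 0 := by
    exact_mod_cast (Nat.card_pos (α := Aut F)).ne'
  simp only [tsum_fintype]
  rw [← Fintype.sum_sigma' (f := fun (ρ : Epis F E) (π : {p : Epis G F // p.1 ≫ ρ.1 = φ}) =>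
      m (quotOf π.1.1 π.1.2) / (Nat.card (Aut F) : ℝ))]
  rw [Fintype.sum_equiv (pairEquiv φ hφ)
    (fun x : Σ ρ : Epis F E, {p : Epis G F // p.1 ≫ ρ.1 = φ} =>
      m (quotOf x.2.1.1 x.2.1.2) / (Nat.card (Aut F) : ℝ))
    (fun p => m (quotOf p.1.1 p.1.2) / (Nat.card (Aut F) : ℝ)) (fun x => rfl)]
  rw [← Finset.sum_subtype (Finset.univ.filter fun p : Epis G F => quotOf φ hφ ≤ quotOf p.1 p.2)
    (by simp) (fun p : Epis G F => m (quotOf p.1 p.2) / (Nat.card (Aut F) : ℝ))]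
  rw [← Finset.sum_fiberwise _ (fun p : Epis G F => quotOf p.1 p.2)]
  refine Finset.sum_congr rfl fun a _ => ?_
  rw [Finset.filter_filter]
  split_ifs with h
  · obtain ⟨hle, ⟨i⟩⟩ := h
    let π₀ : Epis G F := ⟨qArr a ≫ i.hom, epiComp (qArr_epi a) inferInstance⟩
    have hπ₀ : quotOf π₀.1 π₀.2 = a := (quotOf_comp_iso _ (qArr_epi a) _ _).trans (quotOf_qArr a)
    have hc : (Finset.univ.filter fun p : Epis G F =>
        quotOf φ hφ ≤ quotOf p.1 p.2 ∧ quotOf p.1 p.2 = a).card = Nat.card (Aut F) := by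
      rw [show Nat.card (Aut F) = Nat.card (F ≅ F) from rfl, Nat.card_congr (fibreEquiv π₀), Nat.card_eq_fintype_card, Fintype.card_subtype]
      congr 1
      ext p
      simp only [Finset.mem_filter, Finset.mem_univ, true_and, hπ₀]
      exact ⟨fun h => h.2, fun h => ⟨h ▸ hle, h⟩⟩
    rw [Finset.sum_congr rfl (g := fun _ => m a / (Nat.card (Aut F) : ℝ)), Finset.sum_const, hc,
      nsmul_eq_mul, mul_div_cancel₀ _ hcard]
    intro p hp
    simp only [Finset.mem_filter] at hp
    rw [hp.2.2]
  · refine Finset.sum_eq_zero fun p hp => ?_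
    simp only [Finset.mem_filter, Finset.mem_univ, true_and] at hp
    exact absurd ⟨hp.2 ▸ hp.1, hp.2 ▸ qObj_quotOf p.1 p.2⟩ h

theorem iso_out_iff (X : C) (Y : IsoCls C) : Nonempty (X ≅ Y.out) ↔ Y = cls X := by
  constructor
  · intro h
    rw [← Quotient.out_eq Y]
    exact (Quotient.sound (s := CategoryTheory.isIsomorphicSetoid C) h).symm
  · rintro rfl
    obtain ⟨i⟩ := Quotient.mk_out (s := CategoryTheory.isIsomorphicSetoid C) X
    exact ⟨i.symm⟩

end Cat

end MomentCat

open MomentCat in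
/-- Lemma 4.6: if `φ : G → E` is an epimorphism that is not
relative-`W` and `H̄ ∈ W`, then
`∑_{F : F^W ≅ H̄} ∑_{ρ ∈ Epi(F,E)} ∑_{π ∈ Epi(G,F), ρπ = φ} μ(π)/|Aut F| = 0`. -/
theorem statement6 {C : Type u} [SmallCategory C] (hC : IsDiamond C)
    (mob : ∀ G : C, Quotients G → Quotients G → ℝ) (hmob : IsMobiusFamily mob)
    (W : Set C) (hW : IsFormation W)
    (G E : C) (φ : G ⟶ E) (hφ : Epi φ) (hnr : ¬ RelativeW W φ hφ)
    (Hb : C) (hHb : Hb ∈ W) :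
    (∑' F : {X : IsoCls C // Nonempty (qObj (wQuot W X.out) ≅ Hb)},
      ∑' ρ : Epis F.1.out E,
        ∑' π : {p : Epis G F.1.out // p.1 ≫ ρ.1 = φ},
          mob G (quotOf π.1.1 π.1.2) ⊤ / (Nat.card (Aut F.1.out) : ℝ)) = 0 := by
  haveI := hC.quotFinite G
  haveI := Fintype.ofFinite (Quotients G)
  have hin := fun F : {X : IsoCls C // Nonempty (qObj (wQuot W X.out) ≅ Hb)} =>
    inner_sum hC (F := F.1.out) φ hφ (fun a => mob G a ⊤)
  rw [tsum_congr hin]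
  have hout : ∀ a : Quotients G,
      HasSum (fun F : {X : IsoCls C // Nonempty (qObj (wQuot W X.out) ≅ Hb)} =>
        if quotOf φ hφ ≤ a ∧ Nonempty (qObj a ≅ F.1.out) then mob G a ⊤ else 0)
      (if quotOf φ hφ ≤ a ∧ Nonempty (qObj (qInf a (wQuot W G)) ≅ Hb)
        then mob G a ⊤ else 0) := by
    intro a
    have key : Nonempty (qObj (wQuot W (cls (qObj a)).out) ≅ Hb) ↔
        Nonempty (qObj (qInf a (wQuot W G)) ≅ Hb) := by
      obtain ⟨i⟩ := (iso_out_iff (qObj a) (cls (qObj a))).2 rfl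
      obtain ⟨j⟩ := wQuot_quot hC hW (qArr a ≫ i.hom) (epiComp (qArr_epi a) inferInstance)
      rw [quotOf_comp_iso _ (qArr_epi a), quotOf_qArr] at j
      exact ⟨fun ⟨k⟩ => ⟨j.symm ≪≫ k⟩, fun ⟨k⟩ => ⟨j ≪≫ k⟩⟩
    simp only [iso_out_iff]
    by_cases hP : Nonempty (qObj (qInf a (wQuot W G)) ≅ Hb)
    · have hs := hasSum_single (f := fun F : {X : IsoCls C //
          Nonempty (qObj (wQuot W X.out) ≅ Hb)} =>
          if quotOf φ hφ ≤ a ∧ F.1 = cls (qObj a) then mob G a ⊤ else 0)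
        ⟨cls (qObj a), key.2 hP⟩ ?_
      · simp only [hP, and_true] at hs ⊢
        exact hs
      · intro F hF
        rw [if_neg]
        rintro ⟨_, h⟩
        exact hF (Subtype.ext h)
    · rw [if_neg (fun h => hP h.2)]
      convert! hasSum_zero with F
      rw [if_neg]
      rintro ⟨_, h⟩
      exact hP (key.1 (h ▸ F.2))
  rw [(hasSum_sum (s := Finset.univ) fun a _ => hout a).tsum_eq, ← Finset.sum_filter]
  have hlub := qSup_isLUB hC (wQuot W G) (quotOf φ hφ)
  have hw1 : wQuot W G ≤ qSup (wQuot W G) (quotOf φ hφ) := hlub.1 (by simp)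
  have hw2 : quotOf φ hφ ≤ qSup (wQuot W G) (quotOf φ hφ) := hlub.1 (by simp)
  have hg := fun a : Quotients G => qInf_isGLB hC a (qSup (wQuot W G) (quotOf φ hφ))
  refine weisner_pred (fun a => mob G a ⊤) (mob_dual (mob G) (hmob G).1 (hmob G).2)
    (qSup (wQuot W G) (quotOf φ hφ)) hnr (fun a => qInf a (qSup (wQuot W G) (quotOf φ hφ)))
    hg (fun a => quotOf φ hφ ≤ a ∧ Nonempty (qObj (qInf a (wQuot W G)) ≅ Hb)) ?_
  have hle : ∀ a b : Quotients G, qInf a (qSup (wQuot W G) (quotOf φ hφ)) =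
      qInf b (qSup (wQuot W G) (quotOf φ hφ)) → ∀ x ≤ qSup (wQuot W G) (quotOf φ hφ),
      x ≤ a → x ≤ b := by
    intro a b hab x hx hxa
    have : x ≤ qInf a (qSup (wQuot W G) (quotOf φ hφ)) := by
      rw [le_isGLB_iff (hg a)]
      rintro y (rfl | rfl)
      · exact hxa
      · exact hx
    rw [hab] at this
    exact this.trans ((hg b).1 (by simp))
  rintro a b hab ⟨h1, h2⟩
  refine ⟨hle a b hab _ hw2 h1, ?_⟩
  have heq : qInf a (wQuot W G) = qInf b (wQuot W G) := by
    have hga := qInf_isGLB hC a (wQuot W G)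
    have hgb := qInf_isGLB hC b (wQuot W G)
    have a1 : qInf a (wQuot W G) ≤ a := hga.1 (by simp)
    have a2 : qInf a (wQuot W G) ≤ wQuot W G := hga.1 (by simp)
    have b1 : qInf b (wQuot W G) ≤ b := hgb.1 (by simp)
    have b2 : qInf b (wQuot W G) ≤ wQuot W G := hgb.1 (by simp)
    apply le_antisymm
    · rw [le_isGLB_iff hgb]
      rintro y (rfl | rfl)
      · exact hle _ _ hab _ (a2.trans hw1) a1
      · exact a2
    · rw [le_isGLB_iff hga]
      rintro y (rfl | rfl)
      · exact hle _ _ hab.symm _ (b2.trans hw1) b1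
      · exact b2
  rw [← heq]
  exact h2
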